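/- Let T : [0,1] → [0,1] be Borel measurable with a T-invariant probability measure λ_T that is absolutely continuous with respect to Lebesgue measure and satisfies λ_T((0,1)) = 1. Let U₀ have law λ_T, set μ_t := T^{t−1}(U₀) for t ≥ 1, and let Y = (Y_t)_{t≥1} have the βARC conditional structure with μ = (μ_t)_{t≥1} and precision ν > 0. If there exists q ∈ [0,1) such that ∑_{k=1}^∞ |Cov(μ_1, μ_{1+k})| / k^q < ∞, then (1/n) ∑_{ℓ=1}^{n} Y_ℓ → ∫₀¹ z dλ_T(z) almost surely as n → ∞. -/

import Mathlib

open MeasureTheory Set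

/-- The density of the Beta(νz, ν(1-z)) distribution on (0,1), as in the paper. -/
noncomputable def betaDen (ν z y : ℝ) : ℝ :=
  Set.indicator (Set.Ioo 0 1)
    (fun y => Real.Gamma ν / (Real.Gamma (ν * z) * Real.Gamma (ν * (1 - z))) *
      y ^ (ν * z - 1) * (1 - y) ^ (ν * (1 - z) - 1)) y

/-- The Beta(νz, ν(1-z)) probability distribution on (0,1) (as a measure on ℝ). -/
noncomputable def betaMeas (ν z : ℝ) : Measure ℝ :=
  volume.withDensity (fun y => ENNReal.ofReal (betaDen ν z y))

/-- Processes `Y` and `μ` taking values in `(0,1)` have the βARC conditional structure with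
precision `ν`: for all distinct times and Borel sets `A j, B j ⊆ (0,1)`,
`P(∀j, Y (t j) ∈ A j, μ (t j) ∈ B j) = E[∏ j, 1_{B j}(μ (t j)) · Beta(ν μ, ν(1-μ))(A j)]`,
i.e. conditionally on `μ` the `Y`'s are independent with `Y t ∼ Beta(ν μ t, ν(1-μ t))`. -/
def IsBetaARC {Ω : Type*} [MeasurableSpace Ω] (P : Measure Ω) (ν : ℝ)
    (Y μ : ℕ → Ω → ℝ) : Prop :=
  (∀ t, Measurable (Y t)) ∧ (∀ t, Measurable (μ t)) ∧
  (∀ t, ∀ᵐ ω ∂P, Y t ω ∈ Set.Ioo (0 : ℝ) 1) ∧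
  (∀ t, ∀ᵐ ω ∂P, μ t ω ∈ Set.Ioo (0 : ℝ) 1) ∧
  ∀ (k : ℕ) (t : Fin k → ℕ), Function.Injective t →
    ∀ A B : Fin k → Set ℝ, (∀ j, MeasurableSet (A j)) → (∀ j, MeasurableSet (B j)) →
      (∀ j, A j ⊆ Set.Ioo 0 1) → (∀ j, B j ⊆ Set.Ioo 0 1) →
      P {ω | ∀ j, Y (t j) ω ∈ A j ∧ μ (t j) ω ∈ B j} =
        ∫⁻ ω, ∏ j, ((B j).indicator 1 (μ (t j) ω) * betaMeas ν (μ (t j) ω) (A j)) ∂P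

/-- Covariance `Cov(X,Z) = E[XZ] - E[X]E[Z]`. -/
noncomputable def cov {Ω : Type*} [MeasurableSpace Ω] (P : Measure Ω) (X Z : Ω → ℝ) : ℝ :=
  ∫ ω, X ω * Z ω ∂P - (∫ ω, X ω ∂P) * (∫ ω, Z ω ∂P)

open ProbabilityTheory Filter
open scoped ENNReal Topology

lemma betaDen_eq_betaPDFReal (ν z y : ℝ) :
    betaDen ν z y = betaPDFReal (ν * z) (ν * (1 - z)) y := by
  have h : ν * z + ν * (1 - z) = ν := by ring
  simp only [betaDen, betaPDFReal, beta, h, Set.indicator_apply, Set.mem_Ioo, one_div_div]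

lemma betaMeas_eq_betaMeasure (ν z : ℝ) :
    betaMeas ν z = betaMeasure (ν * z) (ν * (1 - z)) := by
  simp only [betaMeas, betaMeasure, betaDen_eq_betaPDFReal]
  rfl

lemma isProbabilityMeasure_betaMeas {ν z : ℝ} (hν : 0 < ν) (hz : z ∈ Ioo (0 : ℝ) 1) :
    IsProbabilityMeasure (betaMeas ν z) := by
  rw [betaMeas_eq_betaMeasure]
  exact isProbabilityMeasureBeta (mul_pos hν hz.1) (mul_pos hν (sub_pos.2 hz.2))

lemma measurable_betaPDF (α β : ℝ) : Measurable (betaPDF α β) :=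
  (measurable_betaPDFReal α β).ennreal_ofReal

lemma mul_betaPDFReal {α β : ℝ} (hα : 0 < α) (hβ : 0 < β) (y : ℝ) :
    y * betaPDFReal α β y = α / (α + β) * betaPDFReal (α + 1) β y := by
  simp only [betaPDFReal]
  split_ifs with hy
  · have h1 : y ^ (α + 1 - 1) = y * y ^ (α - 1) := by
      rw [← Real.rpow_one_add' hy.1.le (by simpa using hα.ne')]
      congr 1; ring
    have h2 : α + 1 + β = (α + β) + 1 := by ring
    have := (Real.Gamma_pos_of_pos hα).ne'
    have := (Real.Gamma_pos_of_pos hβ).ne'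
    have := (Real.Gamma_pos_of_pos (add_pos hα hβ)).ne'
    have := (add_pos hα hβ).ne'
    rw [h1, beta, beta, h2, Real.Gamma_add_one hα.ne', Real.Gamma_add_one (add_pos hα hβ).ne']
    field_simp
  · simp

/-- The mean of the beta distribution. -/
lemma lintegral_betaMeasure {α β : ℝ} (hα : 0 < α) (hβ : 0 < β) :
    ∫⁻ y, ENNReal.ofReal y ∂(betaMeasure α β) = ENNReal.ofReal (α / (α + β)) := by
  rw [betaMeasure, lintegral_withDensity_eq_lintegral_mul _ (measurable_betaPDF α β)
    (by fun_prop)]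
  have h : ∀ y, (betaPDF α β * fun y => ENNReal.ofReal y) y =
      ENNReal.ofReal (α / (α + β)) * betaPDF (α + 1) β y := by
    intro y
    have hαβ : 0 ≤ α / (α + β) := by positivity
    simp only [Pi.mul_apply, betaPDF]
    rw [← ENNReal.ofReal_mul hαβ, ← mul_betaPDFReal hα hβ, mul_comm]
    rcases le_or_gt y 0 with hy | hy
    · have : betaPDFReal α β y = 0 := by simp [betaPDFReal, hy.not_gt]
      simp [this]
    · rw [ENNReal.ofReal_mul hy.le]
  simp_rw [h]
  rw [lintegral_const_mul _ (measurable_betaPDF _ _),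
    lintegral_betaPDF_eq_one (by positivity) hβ, mul_one]

lemma lintegral_betaMeas {ν z : ℝ} (hν : 0 < ν) (hz : z ∈ Ioo (0 : ℝ) 1) :
    ∫⁻ y, ENNReal.ofReal y ∂(betaMeas ν z) = ENNReal.ofReal z := by
  rw [betaMeas_eq_betaMeasure,
    lintegral_betaMeasure (mul_pos hν hz.1) (mul_pos hν (sub_pos.2 hz.2))]
  congr 1
  field_simp
  ring

lemma betaMeas_inter_Ioo (ν z : ℝ) (A : Set ℝ) :
    betaMeas ν z (A ∩ Ioo 0 1) = betaMeas ν z A := by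
  refine measure_inter_conull ?_
  rw [betaMeas, withDensity_apply _ measurableSet_Ioo.compl]
  refine setLIntegral_eq_zero measurableSet_Ioo.compl fun y hy => ?_
  simp [betaDen, Set.indicator_of_notMem hy]

/-- The beta densities, set to zero when the mean parameter is outside `(0,1)`. -/
noncomputable def betaKernelDen (ν z y : ℝ) : ℝ≥0∞ :=
  (Ioo (0 : ℝ) 1).indicator (fun z => ENNReal.ofReal (betaDen ν z y)) z

lemma measurable_betaKernelDen {ν : ℝ} (hν : 0 < ν) :
    Measurable (Function.uncurry (betaKernelDen ν)) := by
  classical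
  let c : ℝ → ℝ := (Ioo (0 : ℝ) 1).piecewise
    (fun z => Real.Gamma ν / (Real.Gamma (ν * z) * Real.Gamma (ν * (1 - z)))) 0
  have hΓ : ∀ x : ℝ, 0 < x → ContinuousAt Real.Gamma x := fun x hx =>
    (Real.differentiableAt_Gamma fun m => by
      have := m.cast_nonneg (α := ℝ); linarith).continuousAt
  have hc : Measurable c := by
    refine ContinuousOn.measurable_piecewise (fun z hz => ?_) continuousOn_const measurableSet_Ioo
    have h1 := mul_pos hν hz.1
    have h2 := mul_pos hν (sub_pos.2 hz.2)
    refine (ContinuousAt.div continuousAt_const (ContinuousAt.mul ?_ ?_)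
      (mul_pos (Real.Gamma_pos_of_pos h1) (Real.Gamma_pos_of_pos h2)).ne').continuousWithinAt
    · exact ContinuousAt.comp (f := fun z => ν * z) (hΓ _ h1) (by fun_prop)
    · exact ContinuousAt.comp (f := fun z => ν * (1 - z)) (hΓ _ h2) (by fun_prop)
  have h : Function.uncurry (betaKernelDen ν) =
      (Ioo (0 : ℝ) 1 ×ˢ Ioo (0 : ℝ) 1).indicator fun p : ℝ × ℝ =>
        ENNReal.ofReal (c p.1 * p.2 ^ (ν * p.1 - 1) * (1 - p.2) ^ (ν * (1 - p.1) - 1)) := by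
    ext ⟨z, y⟩
    by_cases hz : z ∈ Ioo (0 : ℝ) 1 <;> by_cases hy : y ∈ Ioo (0 : ℝ) 1
    · have hp : (z, y) ∈ Ioo (0 : ℝ) 1 ×ˢ Ioo (0 : ℝ) 1 := ⟨hz, hy⟩
      rw [Set.indicator_of_mem hp]
      simp [betaKernelDen, betaDen, c, hz, hy, -mem_Ioo]
    all_goals simp [betaKernelDen, betaDen, hz, hy, -mem_Ioo]
  rw [h]
  exact Measurable.indicator (by fun_prop) (measurableSet_Ioo.prod measurableSet_Ioo)

/-- The kernel `z ↦ Beta(νz, ν(1-z))` for `z ∈ (0,1)`, and zero elsewhere. -/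
noncomputable def betaKernel (ν : ℝ) : Kernel ℝ ℝ :=
  Kernel.withDensity (Kernel.const ℝ volume) (betaKernelDen ν)

lemma betaKernel_apply {ν z : ℝ} (hν : 0 < ν) (hz : z ∈ Ioo (0 : ℝ) 1) :
    betaKernel ν z = betaMeas ν z := by
  rw [betaKernel, Kernel.withDensity_apply _ (measurable_betaKernelDen hν), Kernel.const_apply,
    betaMeas]
  congr 1
  ext y
  simp [betaKernelDen, hz, -mem_Ioo]

lemma betaKernel_apply_of_notMem {ν z : ℝ} (hν : 0 < ν) (hz : z ∉ Ioo (0 : ℝ) 1) :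
    betaKernel ν z = 0 := by
  rw [betaKernel, Kernel.withDensity_apply _ (measurable_betaKernelDen hν), Kernel.const_apply]
  convert withDensity_zero
  ext y
  simp [betaKernelDen, hz, -mem_Ioo]

lemma isFiniteKernel_betaKernel {ν : ℝ} (hν : 0 < ν) : IsFiniteKernel (betaKernel ν) := by
  refine ⟨1, by simp, fun z => ?_⟩
  by_cases hz : z ∈ Ioo (0 : ℝ) 1
  · have := isProbabilityMeasure_betaMeas hν hz
    rw [betaKernel_apply hν hz, measure_univ]
  · simp [betaKernel_apply_of_notMem hν hz]

lemma IsBetaARC.measure_pair {Ω : Type*} [MeasurableSpace Ω] {P : Measure Ω} {ν : ℝ}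
    {Y μ : ℕ → Ω → ℝ} (h : IsBetaARC P ν Y μ) {s t : ℕ} (hst : s ≠ t) {A B : Set ℝ}
    (hA : MeasurableSet A) (hB : MeasurableSet B) :
    P {ω | Y s ω ∈ A ∧ Y t ω ∈ B} =
      ∫⁻ ω, betaMeas ν (μ s ω) A * betaMeas ν (μ t ω) B ∂P := by
  obtain ⟨-, -, hY, hμ, h⟩ := h
  have key := h 2 ![s, t] (by intro i j; fin_cases i <;> fin_cases j <;> simp [hst, hst.symm])
    ![A ∩ Ioo 0 1, B ∩ Ioo 0 1] (fun _ => Ioo 0 1)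
    (by intro j; fin_cases j <;> simp [hA, hB, MeasurableSet.inter])
    (fun _ => measurableSet_Ioo) (by intro j; fin_cases j <;> simp) (fun _ => subset_rfl)
  calc P {ω | Y s ω ∈ A ∧ Y t ω ∈ B} = _ := measure_congr ?_
    _ = _ := key
    _ = _ := lintegral_congr_ae ?_
  · filter_upwards [hY s, hY t, hμ s, hμ t] with ω h1 h2 h3 h4
    refine propext (?_ : (Y s ω ∈ A ∧ Y t ω ∈ B) ↔ _)
    change _ ↔ ∀ j, _
    simp [Fin.forall_fin_two, h1, h2, h3, h4, -mem_Ioo]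
  · filter_upwards [hμ s, hμ t] with ω h3 h4
    simp [Fin.prod_univ_two, h3, h4, betaMeas_inter_Ioo, -mem_Ioo]

lemma IsBetaARC.measure_single {Ω : Type*} [MeasurableSpace Ω] {P : Measure Ω} {ν : ℝ}
    {Y μ : ℕ → Ω → ℝ} (hν : 0 < ν) (h : IsBetaARC P ν Y μ) (s : ℕ) {A : Set ℝ}
    (hA : MeasurableSet A) :
    P {ω | Y s ω ∈ A} = ∫⁻ ω, betaMeas ν (μ s ω) A ∂P := by
  have key := h.measure_pair (Nat.succ_ne_self s).symm hA MeasurableSet.univ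
  simp only [mem_univ, and_true] at key
  rw [key]
  refine lintegral_congr_ae ?_
  filter_upwards [h.2.2.2.1 (s + 1)] with ω hω
  have := isProbabilityMeasure_betaMeas hν hω
  simp

lemma IsBetaARC.map_pair {Ω : Type*} [MeasurableSpace Ω] {P : Measure Ω} [IsProbabilityMeasure P]
    {ν : ℝ} (hν : 0 < ν) {Y μ : ℕ → Ω → ℝ} (h : IsBetaARC P ν Y μ) {s t : ℕ} (hst : s ≠ t) :
    P.map (fun ω => (Y s ω, Y t ω)) =
      P.bind ((betaKernel ν).comap (μ s) (h.2.1 s) ×ₖ (betaKernel ν).comap (μ t) (h.2.1 t)) := by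
  have := isFiniteKernel_betaKernel hν
  have hmeas : Measurable fun ω => (Y s ω, Y t ω) := (h.1 s).prodMk (h.1 t)
  have := Measure.isProbabilityMeasure_map (μ := P) hmeas.aemeasurable
  refine Measure.ext_prod fun {A B} hA hB => ?_
  rw [Measure.map_apply hmeas (hA.prod hB),
    Measure.bind_apply (hA.prod hB) (Kernel.aemeasurable _)]
  refine (h.measure_pair hst hA hB).trans (lintegral_congr_ae ?_)
  filter_upwards [h.2.2.2.1 s, h.2.2.2.1 t] with ω h3 h4
  rw [Kernel.prod_apply_prod, Kernel.comap_apply, Kernel.comap_apply, betaKernel_apply hν h3,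
    betaKernel_apply hν h4]

lemma IsBetaARC.map_single {Ω : Type*} [MeasurableSpace Ω] {P : Measure Ω}
    {ν : ℝ} (hν : 0 < ν) {Y μ : ℕ → Ω → ℝ} (h : IsBetaARC P ν Y μ) (s : ℕ) :
    P.map (Y s) = P.bind ((betaKernel ν).comap (μ s) (h.2.1 s)) := by
  ext A hA
  rw [Measure.map_apply (h.1 s) hA, Measure.bind_apply hA (Kernel.aemeasurable _)]
  refine (h.measure_single hν s hA).trans (lintegral_congr_ae ?_)
  filter_upwards [h.2.2.2.1 s] with ω h3
  rw [Kernel.comap_apply, betaKernel_apply hν h3]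

lemma IsBetaARC.integral_eq {Ω : Type*} [MeasurableSpace Ω] {P : Measure Ω}
    {ν : ℝ} (hν : 0 < ν) {Y μ : ℕ → Ω → ℝ} (h : IsBetaARC P ν Y μ) (s : ℕ) :
    ∫ ω, Y s ω ∂P = ∫ ω, μ s ω ∂P := by
  rw [integral_eq_lintegral_of_nonneg_ae ((h.2.2.1 s).mono fun ω hω => hω.1.le)
      (h.1 s).aestronglyMeasurable,
    integral_eq_lintegral_of_nonneg_ae ((h.2.2.2.1 s).mono fun ω hω => hω.1.le)
      (h.2.1 s).aestronglyMeasurable]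
  congr 1
  rw [← lintegral_map (f := ENNReal.ofReal) ENNReal.measurable_ofReal (h.1 s), h.map_single hν,
    Measure.lintegral_bind (Kernel.aemeasurable _) (by fun_prop)]
  refine lintegral_congr_ae ?_
  filter_upwards [h.2.2.2.1 s] with ω h3
  rw [Kernel.comap_apply, betaKernel_apply hν h3, lintegral_betaMeas hν h3]

lemma IsBetaARC.integral_mul_eq {Ω : Type*} [MeasurableSpace Ω] {P : Measure Ω}
    [IsProbabilityMeasure P] {ν : ℝ} (hν : 0 < ν) {Y μ : ℕ → Ω → ℝ} (h : IsBetaARC P ν Y μ)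
    {s t : ℕ} (hst : s ≠ t) :
    ∫ ω, Y s ω * Y t ω ∂P = ∫ ω, μ s ω * μ t ω ∂P := by
  have := isFiniteKernel_betaKernel hν
  have hY : ∀ᵐ ω ∂P, 0 ≤ Y s ω * Y t ω := by
    filter_upwards [h.2.2.1 s, h.2.2.1 t] with ω h1 h2 using mul_nonneg h1.1.le h2.1.le
  have hμ : ∀ᵐ ω ∂P, 0 ≤ μ s ω * μ t ω := by
    filter_upwards [h.2.2.2.1 s, h.2.2.2.1 t] with ω h1 h2 using mul_nonneg h1.1.le h2.1.le
  rw [integral_eq_lintegral_of_nonneg_ae hY ((h.1 s).mul (h.1 t)).aestronglyMeasurable,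
    integral_eq_lintegral_of_nonneg_ae hμ ((h.2.1 s).mul (h.2.1 t)).aestronglyMeasurable]
  congr 1
  have hg : Measurable fun p : ℝ × ℝ => ENNReal.ofReal p.1 * ENNReal.ofReal p.2 := by fun_prop
  calc ∫⁻ ω, ENNReal.ofReal (Y s ω * Y t ω) ∂P
      = ∫⁻ ω, ENNReal.ofReal (Y s ω) * ENNReal.ofReal (Y t ω) ∂P := by
        refine lintegral_congr_ae ?_
        filter_upwards [h.2.2.1 s] with ω h1
        rw [ENNReal.ofReal_mul h1.1.le]
    _ = ∫⁻ p, ENNReal.ofReal p.1 * ENNReal.ofReal p.2 ∂(P.map fun ω => (Y s ω, Y t ω)) :=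
        (lintegral_map hg ((h.1 s).prodMk (h.1 t))).symm
    _ = ∫⁻ ω, ENNReal.ofReal (μ s ω * μ t ω) ∂P := by
        rw [h.map_pair hν hst, Measure.lintegral_bind (Kernel.aemeasurable _) hg.aemeasurable]
        refine lintegral_congr_ae ?_
        filter_upwards [h.2.2.2.1 s, h.2.2.2.1 t] with ω h3 h4
        have := isProbabilityMeasure_betaMeas hν h3
        have := isProbabilityMeasure_betaMeas hν h4
        rw [Kernel.prod_apply, Kernel.comap_apply, Kernel.comap_apply, betaKernel_apply hν h3,
          betaKernel_apply hν h4,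
          lintegral_prod_mul (f := ENNReal.ofReal) (g := ENNReal.ofReal) (by fun_prop)
            (by fun_prop), lintegral_betaMeas hν h3, lintegral_betaMeas hν h4,
          ENNReal.ofReal_mul h3.1.le]

lemma integral_sq_sum_le_of_abs_integral_mul_le {Ω : Type*} [MeasurableSpace Ω] {P : Measure Ω}
    [IsProbabilityMeasure P] {d : ℕ → Ω → ℝ} (hd : ∀ t, Measurable (d t))
    (hd1 : ∀ t, ∀ᵐ ω ∂P, |d t ω| ≤ 1) {a : ℕ → ℝ} (ha : ∀ k, 0 ≤ a k)
    (hcov : ∀ s t, s < t → |∫ ω, d s ω * d t ω ∂P| ≤ a (t - s - 1)) (n : ℕ) :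
    ∫ ω, (∑ i ∈ Finset.range n, d i ω) ^ 2 ∂P ≤
      n * (1 + 2 * ∑ k ∈ Finset.range n, a k) := by
  have hint : ∀ s t, Integrable (fun ω => d s ω * d t ω) P := fun s t => by
    refine Integrable.of_bound ((hd s).mul (hd t)).aestronglyMeasurable 1 ?_
    filter_upwards [hd1 s, hd1 t] with ω h1 h2
    rw [Real.norm_eq_abs, abs_mul]
    exact mul_le_one₀ h1 (abs_nonneg _) h2
  have hintsum : ∀ n t, Integrable (fun ω => ∑ i ∈ Finset.range n, d i ω * d t ω) P :=
    fun n t => integrable_finsetSum _ fun i _ => hint i t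
  have hintsq : ∀ n, Integrable (fun ω => (∑ i ∈ Finset.range n, d i ω) ^ 2) P := fun n => by
    simp_rw [sq, Finset.sum_mul_sum]
    exact integrable_finsetSum _ fun i _ => integrable_finsetSum _ fun j _ => hint i j
  induction n with
  | zero => simp
  | succ n ih =>
    have hexp : ∀ ω, (∑ i ∈ Finset.range (n + 1), d i ω) ^ 2 =
        (∑ i ∈ Finset.range n, d i ω) ^ 2 + 2 * (∑ i ∈ Finset.range n, d i ω * d n ω) +
          d n ω * d n ω := fun ω => by
      rw [Finset.sum_range_succ, ← Finset.sum_mul]; ring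
    have hcross : ∫ ω, ∑ i ∈ Finset.range n, d i ω * d n ω ∂P ≤ ∑ k ∈ Finset.range n, a k := by
      rw [integral_finsetSum _ fun i _ => hint i n, ← Finset.sum_range_reflect a n]
      refine Finset.sum_le_sum fun i hi => (le_abs_self _).trans ?_
      have := hcov i n (Finset.mem_range.1 hi)
      rwa [Nat.sub_right_comm] at this
    have hdiag : ∫ ω, d n ω * d n ω ∂P ≤ 1 := by
      calc ∫ ω, d n ω * d n ω ∂P ≤ ∫ _, (1 : ℝ) ∂P := by
            refine integral_mono_ae (hint n n) (integrable_const _) ?_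
            filter_upwards [hd1 n] with ω h1
            rw [← abs_mul_abs_self]
            exact mul_le_one₀ h1 (abs_nonneg _) h1
        _ = 1 := by simp
    simp_rw [hexp]
    have hint2 : Integrable (fun ω => (∑ i ∈ Finset.range n, d i ω) ^ 2 +
        2 * ∑ i ∈ Finset.range n, d i ω * d n ω) P := (hintsq n).add ((hintsum n n).const_mul 2)
    rw [integral_add hint2 (hint n n), integral_add (hintsq n) ((hintsum n n).const_mul 2), integral_const_mul,
      Finset.sum_range_succ]
    push_cast
    nlinarith [ha n, mul_nonneg (n.cast_nonneg (α := ℝ)) (ha n)]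

lemma sum_range_le_tsum_mul_rpow {a : ℕ → ℝ} (ha : ∀ k, 0 ≤ a k) {q : ℝ} (hq : 0 ≤ q)
    (hsum : Summable fun k : ℕ => a k / ((k : ℝ) + 1) ^ q) (n : ℕ) :
    ∑ k ∈ Finset.range n, a k ≤ (∑' k : ℕ, a k / ((k : ℝ) + 1) ^ q) * (n : ℝ) ^ q := by
  calc ∑ k ∈ Finset.range n, a k
      ≤ ∑ k ∈ Finset.range n, a k / ((k : ℝ) + 1) ^ q * (n : ℝ) ^ q := by
        refine Finset.sum_le_sum fun k hk => ?_
        have hk' : (k : ℝ) + 1 ≤ n := by exact_mod_cast Finset.mem_range.1 hk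
        rw [div_mul_eq_mul_div, le_div_iff₀ (by positivity)]
        gcongr
        exact ha k
    _ ≤ _ := by
        rw [← Finset.sum_mul]
        gcongr
        exact hsum.sum_le_tsum _ fun k _ => div_nonneg (ha k) (by positivity)

lemma ae_tendsto_zero_of_summable_integral_sq {Ω : Type*} [MeasurableSpace Ω] {P : Measure Ω}
    {f : ℕ → Ω → ℝ} (hf : ∀ j, Measurable (f j))
    (hint : ∀ j, Integrable (fun ω => f j ω ^ 2) P)
    (hsum : Summable fun j => ∫ ω, f j ω ^ 2 ∂P) :
    ∀ᵐ ω ∂P, Tendsto (fun j => f j ω) atTop (𝓝 0) := by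
  have hmeas : ∀ j, Measurable fun ω => ENNReal.ofReal (f j ω ^ 2) := fun j => by fun_prop
  have hfin : ∫⁻ ω, ∑' j, ENNReal.ofReal (f j ω ^ 2) ∂P ≠ ∞ := by
    rw [lintegral_tsum fun j => (hmeas j).aemeasurable]
    simp_rw [← ofReal_integral_eq_lintegral_ofReal (hint _) (ae_of_all _ fun ω => sq_nonneg _)]
    exact hsum.tsum_ofReal_ne_top
  filter_upwards [ae_lt_top (Measurable.tsum hmeas) hfin] with ω hω
  have h := ENNReal.tendsto_atTop_zero_of_tsum_ne_top hω.ne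
  have h2 := (ENNReal.tendsto_toReal ENNReal.zero_ne_top).comp h
  have h3 := h2.sqrt
  refine (tendsto_zero_iff_abs_tendsto_zero _).2 ?_
  simpa [Function.comp_def, ENNReal.toReal_ofReal, sq_nonneg, Real.sqrt_sq_eq_abs] using h3

lemma exists_pow_ae_tendsto_div_of_integral_sq_le {Ω : Type*} [MeasurableSpace Ω] {P : Measure Ω}
    {D : ℕ → Ω → ℝ} (hD : ∀ n, Measurable (D n))
    (hint : ∀ n, Integrable (fun ω => D n ω ^ 2) P) {K q : ℝ} (hq : q < 1)
    (hK : ∀ n : ℕ, 0 < n → ∫ ω, D n ω ^ 2 ∂P ≤ K * (n : ℝ) ^ (1 + q)) :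
    ∃ p : ℕ, p ≠ 0 ∧ ∀ᵐ ω ∂P,
      Tendsto (fun j : ℕ => D ((j + 1) ^ p) ω / (((j + 1) ^ p : ℕ) : ℝ)) atTop (𝓝 0) := by
  obtain ⟨p, hp⟩ := exists_nat_gt (1 / (1 - q))
  have hq' : 0 < 1 - q := sub_pos.2 hq
  have hp0 : (0 : ℝ) < p := (by positivity : (0 : ℝ) < 1 / (1 - q)).trans hp
  have hp1 : (p : ℝ) * (q - 1) < -1 := by
    rw [div_lt_iff₀ hq'] at hp; linarith
  refine ⟨p, by exact_mod_cast hp0.ne', ae_tendsto_zero_of_summable_integral_sq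
    (fun j => (hD _).div_const _) (fun j => ?_) ?_⟩
  · simp_rw [div_pow]
    exact (hint _).div_const _
  have hs : Summable fun j : ℕ => K * ((j + 1 : ℕ) : ℝ) ^ (p * (q - 1)) :=
    ((summable_nat_add_iff 1).2 (Real.summable_nat_rpow.2 hp1)).mul_left K
  refine hs.of_nonneg_of_le (fun j => integral_nonneg fun ω => sq_nonneg _) fun j => ?_
  simp_rw [div_pow]
  rw [integral_div]
  have hj : (0 : ℝ) < (((j + 1) ^ p : ℕ) : ℝ) := by positivity
  rw [div_le_iff₀ (by positivity)]
  refine (hK _ (by positivity)).trans_eq ?_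
  rw [mul_assoc, Real.rpow_mul (by positivity), Real.rpow_natCast, ← Nat.cast_pow,
    ← Real.rpow_natCast _ 2, ← Real.rpow_add hj]
  congr 2
  push_cast
  ring

lemma eventually_succ_pow_le (p : ℕ) {a : ℝ} (ha : 1 < a) :
    ∀ᶠ j : ℕ in atTop, (((j + 1 + 1) ^ p : ℕ) : ℝ) ≤ a * (((j + 1) ^ p : ℕ) : ℝ) := by
  have h : Tendsto (fun j : ℕ => (1 + 1 / ((j : ℝ) + 1)) ^ p) atTop (𝓝 ((1 + 0) ^ p)) :=
    (tendsto_const_nhds.add tendsto_one_div_add_atTop_nhds_zero_nat).pow p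
  rw [add_zero, one_pow] at h
  filter_upwards [h.eventually_lt_const ha] with j hj
  have h1 : (1 : ℝ) + 1 / (j + 1) = (j + 1 + 1) / (j + 1) := by field_simp
  rw [h1, div_pow, div_lt_iff₀ (by positivity)] at hj
  exact_mod_cast hj.le

/-- A strong law of large numbers for `[0,1]`-valued variables with a common mean, under a
weighted summability condition on a bound for the covariances. -/
theorem ae_tendsto_average_of_summable_covariance {Ω : Type*} [MeasurableSpace Ω]
    {P : Measure Ω} [IsProbabilityMeasure P] {X : ℕ → Ω → ℝ} (hX : ∀ t, Measurable (X t))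
    (hX1 : ∀ t, ∀ᵐ ω ∂P, X t ω ∈ Icc (0 : ℝ) 1) {m : ℝ} (hm : m ∈ Icc (0 : ℝ) 1)
    {a : ℕ → ℝ} (ha : ∀ k, 0 ≤ a k)
    (hcov : ∀ s t, s < t → |∫ ω, (X s ω - m) * (X t ω - m) ∂P| ≤ a (t - s - 1))
    {q : ℝ} (hq : q ∈ Ico (0 : ℝ) 1)
    (hsum : Summable fun k : ℕ => a k / ((k : ℝ) + 1) ^ q) :
    ∀ᵐ ω ∂P, Tendsto (fun n : ℕ => (∑ i ∈ Finset.range n, X i ω) / n) atTop (𝓝 m) := by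
  set D : ℕ → Ω → ℝ := fun n ω => ∑ i ∈ Finset.range n, (X i ω - m) with hD
  have hd : ∀ t, Measurable fun ω => X t ω - m := fun t => (hX t).sub_const m
  have hd1 : ∀ t, ∀ᵐ ω ∂P, |X t ω - m| ≤ 1 := fun t => by
    filter_upwards [hX1 t] with ω h
    exact abs_le.2 ⟨by linarith [h.1, hm.2], by linarith [h.2, hm.1]⟩
  have hDm : ∀ n, Measurable (D n) := fun n => Finset.measurable_fun_sum _ fun i _ => hd i
  have hDint : ∀ n, Integrable (fun ω => D n ω ^ 2) P := fun n => by
    refine Integrable.of_bound ((hDm n).pow_const 2).aestronglyMeasurable ((n : ℝ) ^ 2) ?_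
    filter_upwards [ae_all_iff.2 hd1] with ω h
    rw [norm_pow, Real.norm_eq_abs]
    gcongr
    refine (Finset.abs_sum_le_sum_abs _ _).trans ?_
    simpa using Finset.sum_le_sum fun i (_ : i ∈ Finset.range n) => h i
  set C := ∑' k : ℕ, a k / ((k : ℝ) + 1) ^ q
  obtain ⟨p, hp, hlim⟩ := exists_pow_ae_tendsto_div_of_integral_sq_le hDm hDint
    (K := 1 + 2 * C) hq.2 fun n hn => by
      have hn1 : (1 : ℝ) ≤ n := by exact_mod_cast hn
      have hnq : 1 ≤ (n : ℝ) ^ q := Real.one_le_rpow hn1 hq.1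
      calc ∫ ω, D n ω ^ 2 ∂P ≤ n * (1 + 2 * ∑ k ∈ Finset.range n, a k) :=
            integral_sq_sum_le_of_abs_integral_mul_le hd hd1 ha hcov n
        _ ≤ n * ((n : ℝ) ^ q + 2 * (C * (n : ℝ) ^ q)) := by
            gcongr
            exact sum_range_le_tsum_mul_rpow ha hq.1 hsum n
        _ = (1 + 2 * C) * (n : ℝ) ^ (1 + q) := by
            rw [Real.rpow_add (by positivity), Real.rpow_one]; ring
  filter_upwards [hlim, ae_all_iff.2 hX1] with ω hω h01
  refine tendsto_div_of_monotone_of_exists_subseq_tendsto_div _ m ?_ fun b hb =>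
    ⟨fun j => (j + 1) ^ p, eventually_succ_pow_le p hb, ?_, ?_⟩
  · exact monotone_nat_of_le_succ fun n => by
      rw [Finset.sum_range_succ]; linarith [(h01 n).1]
  · exact (tendsto_pow_atTop hp).comp (tendsto_add_atTop_nat 1)
  · have h2 := hω.add_const m
    rw [zero_add] at h2
    refine h2.congr fun j => ?_
    have hj : (((j + 1) ^ p : ℕ) : ℝ) ≠ 0 := by positivity
    simp only [hD, Finset.sum_sub_distrib, Finset.sum_const, Finset.card_range, nsmul_eq_mul]
    field_simp
    ring

/-- **Remark 9.** Pure chaotic βARC model: `T` Borel measurable with ACIM `lam`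
concentrated on `(0,1)`, `U₀ ∼ lam`, `μ t := T^[t] ∘ U₀`, and `Y` with the βARC conditional
structure with `μ` and precision `ν > 0`.  If for some `q ∈ [0,1)`
`∑_{k≥1} |Cov(μ 1, μ (1+k))|/k^q < ∞`, then `(1/n) ∑_{ℓ<n} Y ℓ → ∫₀¹ z dlam(z)` a.s. -/
theorem stmt11 {Ω : Type*} [MeasurableSpace Ω] (P : Measure Ω) [IsProbabilityMeasure P]
    (T : ℝ → ℝ) (hT : Measurable T) (hTmaps : Set.MapsTo T (Set.Icc 0 1) (Set.Icc 0 1))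
    (lam : Measure ℝ) [IsProbabilityMeasure lam]
    (hinv : ∀ A : Set ℝ, MeasurableSet A → lam (T ⁻¹' A) = lam A)
    (hac : lam ≪ volume) (h01 : lam (Set.Ioo 0 1) = 1)
    (U₀ : Ω → ℝ) (hU₀ : Measurable U₀) (hlaw : Measure.map U₀ P = lam)
    (ν : ℝ) (hν : 0 < ν) (Y : ℕ → Ω → ℝ)
    (hARC : IsBetaARC P ν Y (fun t ω => T^[t] (U₀ ω)))
    (q : ℝ) (hq : q ∈ Set.Ico (0 : ℝ) 1)
    (hcov : Summable fun k : ℕ =>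
      |cov P (fun ω => T^[0] (U₀ ω)) (fun ω => T^[k + 1] (U₀ ω))| / ((k : ℝ) + 1) ^ q) :
    ∀ᵐ ω ∂P, Filter.Tendsto
      (fun n : ℕ => (1 / (n : ℝ)) * ∑ ℓ ∈ Finset.range n, Y ℓ ω)
      Filter.atTop (nhds (∫ z in Set.Ioo (0 : ℝ) 1, z ∂lam)) := by
  have hTP : MeasurePreserving T lam lam := ⟨hT, by
    ext A hA
    rw [Measure.map_apply hT hA, hinv A hA]⟩
  have hUP : MeasurePreserving U₀ P lam := ⟨hU₀, hlaw⟩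
  have hlam : ∀ᵐ z ∂lam, z ∈ Ioo (0 : ℝ) 1 := (prob_compl_eq_zero_iff measurableSet_Ioo).2 h01
  set m := ∫ z in Ioo (0 : ℝ) 1, z ∂lam with hmdef
  have hm : m = ∫ z, z ∂lam := by
    rw [hmdef, Measure.restrict_eq_self_of_ae_mem hlam]
  have hm01 : m ∈ Icc (0 : ℝ) 1 := by
    have hid : Integrable (fun z : ℝ => z) lam :=
      Integrable.of_bound measurable_id.aestronglyMeasurable 1 (hlam.mono fun z hz => by
        rw [Real.norm_eq_abs, abs_of_pos hz.1]; exact hz.2.le)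
    rw [hm]
    refine ⟨integral_nonneg_of_ae (hlam.mono fun z hz => hz.1.le), ?_⟩
    simpa using integral_mono_ae hid (integrable_const (1 : ℝ)) (hlam.mono fun z hz => hz.2.le)
  have hμ : ∀ t, ∫ ω, T^[t] (U₀ ω) ∂P = m := fun t => by
    rw [hm, ← ((hTP.iterate t).comp hUP).map_eq,
      integral_map ((hTP.iterate t).comp hUP).aemeasurable (by fun_prop)]
    rfl
  have hY : ∀ t, ∫ ω, Y t ω ∂P = m := fun t => (hARC.integral_eq hν t).trans (hμ t)
  have hstat : ∀ s k, ∫ ω, T^[s] (U₀ ω) * T^[s + k] (U₀ ω) ∂P = ∫ ω, U₀ ω * T^[k] (U₀ ω) ∂P := by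
    have key : ∀ s k, ∫ ω, T^[s] (U₀ ω) * T^[s + k] (U₀ ω) ∂P = ∫ z, z * T^[k] z ∂lam :=
      fun s k => by
        have hk := hT.iterate k
        rw [← ((hTP.iterate s).comp hUP).map_eq,
          integral_map ((hTP.iterate s).comp hUP).aemeasurable
            (by fun_prop)]
        simp_rw [add_comm s k, Function.iterate_add_apply]
        rfl
    intro s k
    rw [key, ← key 0 k]
    simp
  have hYint : ∀ t, Integrable (Y t) P := fun t =>
    Integrable.of_bound (hARC.1 t).aestronglyMeasurable 1 ((hARC.2.2.1 t).mono fun ω hω => by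
      rw [Real.norm_eq_abs, abs_of_pos hω.1]; exact hω.2.le)
  have hYYint : ∀ s t, Integrable (fun ω => Y s ω * Y t ω) P := fun s t => by
    refine Integrable.of_bound ((hARC.1 s).mul (hARC.1 t)).aestronglyMeasurable 1 ?_
    filter_upwards [hARC.2.2.1 s, hARC.2.2.1 t] with ω h1 h2
    rw [Real.norm_eq_abs, abs_of_pos (mul_pos h1.1 h2.1)]
    exact mul_le_one₀ h1.2.le h2.1.le h2.2.le
  have hcovY : ∀ s t, s < t → ∫ ω, (Y s ω - m) * (Y t ω - m) ∂P =
      cov P (fun ω => T^[0] (U₀ ω)) (fun ω => T^[(t - s - 1) + 1] (U₀ ω)) := by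
    intro s t hst
    obtain ⟨k, rfl⟩ := Nat.exists_eq_add_of_lt hst
    have hk : s + k + 1 - s - 1 = k := by omega
    have hexp : ∀ ω, (Y s ω - m) * (Y (s + k + 1) ω - m) =
        Y s ω * Y (s + k + 1) ω - (m * Y s ω + m * Y (s + k + 1) ω - m * m) := fun ω => by ring
    have hlin : Integrable (fun ω => m * Y s ω + m * Y (s + k + 1) ω) P :=
      ((hYint s).const_mul m).add ((hYint _).const_mul m)
    have hlin' : Integrable (fun ω => m * Y s ω + m * Y (s + k + 1) ω - m * m) P :=
      hlin.sub (integrable_const _)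
    simp_rw [hexp]
    rw [integral_sub (hYYint _ _) hlin',
      integral_sub hlin (integrable_const _),
      integral_add ((hYint s).const_mul m) ((hYint _).const_mul m), integral_const_mul,
      integral_const_mul, hY, hY, hARC.integral_mul_eq hν hst.ne, hk, cov, hμ, hμ, add_assoc,
      hstat s (k + 1)]
    simp
  have key := ae_tendsto_average_of_summable_covariance hARC.1
    (fun t => (hARC.2.2.1 t).mono fun ω hω => Ioo_subset_Icc_self hω) hm01
    (fun k => abs_nonneg _) (fun s t hst => (congrArg abs (hcovY s t hst)).le) hq hcov
  filter_upwards [key] with ω hω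
  exact hω.congr fun n => by rw [one_div, inv_mul_eq_div]
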